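/- For the unconditioned critical Galton–Watson tree 𝒯 with offspring distribution ξ, for every integer k ≥ 1 one has E Q_k(𝒯) = 1 + (k − 1) σ²/2, where σ² = Var ξ. -/

import Mathlib

open scoped ENNReal BigOperators
open Set Filter

/-- Plane (ordered rooted) trees. -/
inductive PlaneTree : Type
  | node : List PlaneTree → PlaneTree

namespace PlaneTree

/-- The list of subtrees hanging off the root. -/
def children : PlaneTree → List PlaneTree
  | .node ts => ts

/-- The subtree rooted at a given position (sequence of child indices), if it exists. -/
def subtreeAt : PlaneTree → List ℕ → Option PlaneTree
  | t, [] => some t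
  | .node ts, i :: q =>
    match ts[i]? with
    | some t' => subtreeAt t' q
    | none => none

/-- The vertex set of a tree, with vertices identified with their positions. -/
def vertexSet (t : PlaneTree) : Set (List ℕ) := {q | (subtreeAt t q).isSome}

/-- The number of vertices of a tree. -/
noncomputable def size (t : PlaneTree) : ℕ := (vertexSet t).ncard

/-- The number of children of the vertex at position `q`. -/
def childCount (t : PlaneTree) (q : List ℕ) : ℕ :=
  ((subtreeAt t q).map fun t' => t'.children.length).getD 0

end PlaneTree

/-- Longest common prefix of two positions; this is the position of the last common
ancestor of the two vertices. -/
def lca : List ℕ → List ℕ → List ℕ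
  | a :: as, b :: bs => if a = b then a :: lca as bs else []
  | _, _ => []

/-- The distance from `v` up to the last common ancestor of `v` and `w`. -/
def dUp (v w : List ℕ) : ℕ := v.length - (lca v w).length

/-- The graph distance between the vertices at positions `v` and `w`. -/
def treeDist (v w : List ℕ) : ℕ := dUp v w + dUp w v

/-- The Galton–Watson probability of a given finite tree: the product, over all vertices,
of the probability that the offspring distribution takes the value given by the number of
children of the vertex. -/
noncomputable def gwProb (p : ℕ → ℝ≥0∞) (t : PlaneTree) : ℝ≥0∞ :=
  ∏ᶠ v ∈ PlaneTree.vertexSet t, p (PlaneTree.childCount t v)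

/-- `P(|𝒯| = n)` for the Galton–Watson tree `𝒯`. -/
noncomputable def probSize (p : ℕ → ℝ≥0∞) (n : ℕ) : ℝ≥0∞ :=
  ∑' t : PlaneTree, if PlaneTree.size t = n then gwProb p t else 0

/-- `E f(T_n)` where `T_n` is the Galton–Watson tree conditioned to have `n` vertices. -/
noncomputable def condExp (p : ℕ → ℝ≥0∞) (n : ℕ) (f : PlaneTree → ℝ≥0∞) : ℝ≥0∞ :=
  (∑' t : PlaneTree, if PlaneTree.size t = n then gwProb p t * f t else 0) / probSize p n

/-- The variance of the offspring distribution `p` (which has mean `1`). -/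
noncomputable def xiVar (p : ℕ → ℝ≥0∞) : ℝ≥0∞ :=
  ∑' k : ℕ, p k * ENNReal.ofReal (((k : ℝ) - 1) ^ 2)

/-- `P_k(t)`: the number of unordered pairs of vertices of `t` at graph distance `k`. -/
noncomputable def pairCount (t : PlaneTree) (k : ℕ) : ℕ :=
  {s : Set (List ℕ) | ∃ v w, v ∈ PlaneTree.vertexSet t ∧ w ∈ PlaneTree.vertexSet t ∧
    s = {v, w} ∧ treeDist v w = k}.ncard

/-- The number of unordered pairs of vertices of `t` at graph distance `k` from each other
whose last common ancestor is the vertex at position `u` (equivalently, the pairs of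
vertices of the subtree rooted at `u` whose connecting path passes through `u`; one of the
two vertices may be `u` itself). -/
noncomputable def pairCountThrough (t : PlaneTree) (u : List ℕ) (k : ℕ) : ℕ :=
  {s : Set (List ℕ) | ∃ v w, v ∈ PlaneTree.vertexSet t ∧ w ∈ PlaneTree.vertexSet t ∧
    s = {v, w} ∧ treeDist v w = k ∧ lca v w = u}.ncard

/-- `Q_k(t)`: the number of unordered pairs of vertices of `t` at graph distance `k`
whose connecting path passes through the root of `t`. -/
noncomputable def rootPairCount (t : PlaneTree) (k : ℕ) : ℕ := pairCountThrough t [] k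

namespace ENNReal

/-- The generalized distributive law for finite products of `ℝ≥0∞`-valued sums. -/
theorem tsum_fin_prod {α : Type*} {n : ℕ} (g : Fin n → α → ℝ≥0∞) :
    ∑' f : Fin n → α, ∏ i, g i (f i) = ∏ i, ∑' a, g i a := by
  induction n with
  | zero => simp [tsum_fintype]
  | succ n ih =>
    rw [Fin.prod_univ_succ, ← ih, ← (Fin.consEquiv fun _ => α).tsum_eq, ENNReal.tsum_prod',
      ← ENNReal.tsum_mul_right]
    refine tsum_congr fun a => ?_
    rw [← ENNReal.tsum_mul_left]
    exact tsum_congr fun f => by simp [Fin.consEquiv, Fin.prod_univ_succ]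

theorem tsum_fin_prod_mul_prod_eq_one {α : Type*} {n : ℕ} (g : α → ℝ≥0∞)
    (u : Fin n → α → ℝ≥0∞) (hu : ∀ i, ∑' a, g a * u i a = 1) :
    ∑' f : Fin n → α, (∏ i, g (f i)) * ∏ i, u i (f i) = 1 := by
  simp_rw [← Finset.prod_mul_distrib]
  rw [tsum_fin_prod fun i a => g a * u i a]
  simp [hu]

theorem tsum_fin_prod_mul_apply {α : Type*} {n : ℕ} (g h : α → ℝ≥0∞) (hg : ∑' a, g a = 1)
    (hh : ∑' a, g a * h a = 1) (i : Fin n) :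
    ∑' f : Fin n → α, (∏ j, g (f j)) * h (f i) = 1 := by
  rw [← tsum_fin_prod_mul_prod_eq_one g (fun j a => if j = i then h a else 1)]
  · simp
  · intro j
    split_ifs <;> simp [hg, hh]

theorem tsum_fin_prod_mul_apply_mul_apply {α : Type*} {n : ℕ} (g h h' : α → ℝ≥0∞)
    (hg : ∑' a, g a = 1) (hh : ∑' a, g a * h a = 1) (hh' : ∑' a, g a * h' a = 1)
    {i j : Fin n} (hij : i ≠ j) :
    ∑' f : Fin n → α, (∏ l, g (f l)) * (h (f i) * h' (f j)) = 1 := by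
  rw [← tsum_fin_prod_mul_prod_eq_one g
    (fun l a => (if l = i then h a else 1) * (if l = j then h' a else 1))]
  · simp_rw [Finset.prod_mul_distrib, Finset.prod_ite_eq', Finset.mem_univ, if_true]
  · intro l
    split_ifs with h₁ h₂
    · exact absurd (h₁.symm.trans h₂) hij
    all_goals simp [hg, hh, hh']

theorem monotone_pow_add_mul {s t : ℝ≥0∞} (hst : s + t = 1) :
    Monotone fun n : ℕ => s ^ n + n * t := by
  refine monotone_nat_of_le_succ fun n => ?_
  have hs : s ^ n ≤ 1 := pow_le_one' (hst ▸ le_self_add) n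
  calc s ^ n + n * t = s ^ n * (s + t) + n * t := by rw [hst, mul_one]
    _ = s ^ (n + 1) + (s ^ n * t + n * t) := by ring
    _ ≤ s ^ (n + 1) + (1 * t + n * t) := by gcongr
    _ = s ^ (n + 1) + ((n + 1 : ℕ) : ℝ≥0∞) * t := by push_cast; ring

/-- Strict Bernoulli inequality on the unit interval. -/
theorem one_lt_pow_add_mul {s t : ℝ≥0∞} (hst : s + t = 1) (ht : t ≠ 0) {n : ℕ} (hn : 2 ≤ n) :
    1 < s ^ n + n * t := by
  refine lt_of_lt_of_le ?_ (monotone_pow_add_mul hst hn)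
  calc (1 : ℝ≥0∞) < 1 + t ^ 2 := ENNReal.lt_add_right one_ne_top (pow_ne_zero _ ht)
    _ = (s + t) ^ 2 + t ^ 2 := by rw [hst, one_pow]
    _ = s ^ 2 + 2 * (s + t) * t := by ring
    _ = s ^ 2 + ((2 : ℕ) : ℝ≥0∞) * t := by rw [hst]; simp

end ENNReal

/-- The cardinality of a disjoint union of injective images. -/
theorem Set.ncard_iUnion_image {ι α β : Type*} [Fintype ι] (φ : ι → α → β) (s : ι → Set α)
    (hφ : ∀ i, Function.Injective (φ i)) (hs : ∀ i, (s i).Finite)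
    (hd : ∀ i j, ∀ a ∈ s i, ∀ b ∈ s j, φ i a = φ j b → i = j) :
    (⋃ i, φ i '' s i).ncard = ∑ i, (s i).ncard := by
  rw [Set.ncard_iUnion_of_finite (fun i => (hs i).image _), finsum_eq_sum_of_fintype]
  · exact Finset.sum_congr rfl fun i _ => Set.ncard_image_of_injective _ (hφ i)
  · intro i j hij
    refine Set.disjoint_left.2 ?_
    rintro _ ⟨a, ha, rfl⟩ ⟨b, hb, hab⟩
    exact hij (hd i j a ha b hb hab.symm)

namespace PlaneTree

/-- The tree whose root subtrees are listed by a tuple. -/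
def mk {n : ℕ} (f : Fin n → PlaneTree) : PlaneTree := .node (List.ofFn f)

/-- A plane tree amounts to the tuple of its root subtrees. -/
def equivSigmaTuple : (Σ n, Fin n → PlaneTree) ≃ PlaneTree :=
  List.equivSigmaTuple.symm.trans
    { toFun := .node
      invFun := children
      left_inv := fun _ => rfl
      right_inv := fun ⟨_⟩ => rfl }

theorem tsum_eq_tsum_mk (F : PlaneTree → ℝ≥0∞) :
    ∑' t, F t = ∑' (n : ℕ) (f : Fin n → PlaneTree), F (mk f) := by
  rw [← equivSigmaTuple.tsum_eq, ENNReal.tsum_sigma']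
  rfl

theorem induction_node {P : PlaneTree → Prop}
    (h : ∀ ts : List PlaneTree, (∀ t ∈ ts, P t) → P (.node ts)) (t : PlaneTree) : P t := by
  cases t with
  | node ts => exact h ts fun t _ => induction_node h t
termination_by sizeOf t

theorem induction_mk {P : PlaneTree → Prop}
    (h : ∀ (n : ℕ) (f : Fin n → PlaneTree), (∀ i, P (f i)) → P (mk f)) (t : PlaneTree) : P t := by
  refine induction_node (fun ts ih => ?_) t
  have := h ts.length ts.get fun i => ih _ (ts.get_mem i)
  rwa [mk, List.ofFn_get] at this

theorem subtreeAt_nil (t : PlaneTree) : subtreeAt t [] = some t := by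
  cases t; rfl

theorem subtreeAt_mk_cons {n : ℕ} (f : Fin n → PlaneTree) (i : Fin n) (q : List ℕ) :
    subtreeAt (mk f) (i :: q) = subtreeAt (f i) q := by
  simp [mk, subtreeAt]

theorem nil_mem_vertexSet (t : PlaneTree) : [] ∈ vertexSet t := by
  simp [vertexSet, subtreeAt_nil]

theorem cons_mem_vertexSet_mk {n : ℕ} (f : Fin n → PlaneTree) (a : ℕ) (q : List ℕ) :
    a :: q ∈ vertexSet (mk f) ↔ ∃ i : Fin n, (i : ℕ) = a ∧ q ∈ vertexSet (f i) := by
  by_cases ha : a < n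
  · have := subtreeAt_mk_cons f ⟨a, ha⟩ q
    simp only at this
    constructor
    · exact fun h => ⟨⟨a, ha⟩, rfl, by simpa [vertexSet, this] using h⟩
    · rintro ⟨i, rfl, h⟩
      simpa [vertexSet, this] using h
  · constructor
    · intro h
      simp [vertexSet, mk, subtreeAt, ha] at h
    · rintro ⟨i, rfl, -⟩
      exact absurd i.2 ha

theorem cons_val_mem_vertexSet_mk {n : ℕ} (f : Fin n → PlaneTree) (i : Fin n) (q : List ℕ) :
    (i : ℕ) :: q ∈ vertexSet (mk f) ↔ q ∈ vertexSet (f i) := by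
  rw [vertexSet, Set.mem_ofPred_eq, subtreeAt_mk_cons]
  rfl

theorem vertexSet_mk {n : ℕ} (f : Fin n → PlaneTree) :
    vertexSet (mk f) = insert [] (⋃ i : Fin n, List.cons (i : ℕ) '' vertexSet (f i)) := by
  ext (_ | ⟨a, q⟩)
  · simp [nil_mem_vertexSet]
  · simp [cons_mem_vertexSet_mk, and_comm]

theorem vertexSet_finite (t : PlaneTree) : (vertexSet t).Finite := by
  induction t using induction_mk with
  | h n f ih =>
    rw [vertexSet_mk]
    exact (Set.finite_iUnion fun i => (ih i).image _).insert _

theorem gwProb_mk (p : ℕ → ℝ≥0∞) {n : ℕ} (f : Fin n → PlaneTree) :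
    gwProb p (mk f) = p n * ∏ i, gwProb p (f i) := by
  have hfin (i : Fin n) : (List.cons (i : ℕ) '' vertexSet (f i)).Finite :=
    (vertexSet_finite _).image _
  rw [gwProb, vertexSet_mk, finprod_mem_insert _ (by simp) (Set.finite_iUnion hfin),
    finprod_mem_iUnion _ hfin, finprod_eq_prod_of_fintype]
  · congr 1
    · simp [childCount, subtreeAt_nil, mk, children]
    · refine Finset.prod_congr rfl fun i _ => ?_
      rw [finprod_mem_image List.cons_injective.injOn]
      simp [gwProb, childCount, subtreeAt_mk_cons]
  · intro i j hij
    refine Set.disjoint_left.2 ?_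
    rintro _ ⟨a, -, rfl⟩ ⟨b, -, hab⟩
    exact hij (Fin.ext (List.cons.inj hab).1.symm)

/-- The vertices at height `k`. -/
def level (t : PlaneTree) (k : ℕ) : Set (List ℕ) := {q | q ∈ vertexSet t ∧ q.length = k}

theorem level_finite (t : PlaneTree) (k : ℕ) : (level t k).Finite :=
  (vertexSet_finite t).subset fun _ h => h.1

theorem level_zero (t : PlaneTree) : level t 0 = {[]} := by
  ext q
  simp only [level, Set.mem_ofPred_eq, List.length_eq_zero_iff, Set.mem_singleton_iff]
  exact ⟨fun h => h.2, fun h => ⟨h ▸ nil_mem_vertexSet t, h⟩⟩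

theorem level_mk_succ {n : ℕ} (f : Fin n → PlaneTree) (k : ℕ) :
    level (mk f) (k + 1) = ⋃ i : Fin n, List.cons (i : ℕ) '' level (f i) k := by
  ext (_ | ⟨a, q⟩)
  · simp [level]
  · simp only [level, Set.mem_ofPred_eq, cons_mem_vertexSet_mk, List.length_cons,
      Nat.add_right_cancel_iff, Set.mem_iUnion, Set.mem_image, List.cons.injEq]
    grind

theorem ncard_level_mk_succ {n : ℕ} (f : Fin n → PlaneTree) (k : ℕ) :
    (level (mk f) (k + 1)).ncard = ∑ i, (level (f i) k).ncard := by
  rw [level_mk_succ]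
  refine Set.ncard_iUnion_image _ _ (fun i => List.cons_injective) (fun i => level_finite _ _) ?_
  intro i j a _ b _ h
  exact Fin.ext (List.cons.inj h).1

theorem exists_ncard_level_eq_zero (t : PlaneTree) :
    ∃ H, ∀ k, H ≤ k → (level t k).ncard = 0 := by
  obtain ⟨H, hH⟩ := ((vertexSet_finite t).image List.length).bddAbove
  refine ⟨H + 1, fun k hk => ?_⟩
  rw [Set.ncard_eq_zero (level_finite _ _), Set.eq_empty_iff_forall_notMem]
  rintro q ⟨hq, rfl⟩
  exact absurd (hH ⟨q, hq, rfl⟩) (by omega)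

/-- Indices `i < j` of root subtrees and a height `a`, for splitting a path through the root
into two branches. -/
abbrev BranchIndex (n m : ℕ) : Type := Σ j : Fin n, Fin j × Fin m

/-- The smaller subtree index. -/
def BranchIndex.left {n m : ℕ} (x : BranchIndex n m) : Fin n := ⟨x.2.1, x.2.1.2.trans x.1.2⟩

/-- Ordered pairs of vertices in two different root subtrees, at distance `m + 1`. -/
def branchPairs {n : ℕ} (f : Fin n → PlaneTree) (m : ℕ) : Set (List ℕ × List ℕ) :=
  ⋃ x : BranchIndex n m, Prod.map (List.cons (x.left : ℕ)) (List.cons (x.1 : ℕ)) ''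
    (level (f x.left) x.2.2 ×ˢ level (f x.1) (m - 1 - x.2.2))

theorem finite_branchPairs {n : ℕ} (f : Fin n → PlaneTree) (m : ℕ) :
    (branchPairs f m).Finite :=
  Set.finite_iUnion fun _ => ((level_finite _ _).prod (level_finite _ _)).image _

theorem ncard_branchPairs {n : ℕ} (f : Fin n → PlaneTree) (m : ℕ) :
    (branchPairs f m).ncard = ∑ x : BranchIndex n m,
      (level (f x.left) x.2.2).ncard * (level (f x.1) (m - 1 - x.2.2)).ncard := by
  rw [branchPairs, Set.ncard_iUnion_image]
  · simp [Set.ncard_prod]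
  · exact fun i => List.cons_injective.prodMap List.cons_injective
  · exact fun i => (level_finite _ _).prod (level_finite _ _)
  · rintro ⟨j, i, a⟩ ⟨j', i', a'⟩ ⟨v, w⟩ ⟨hv, hw⟩ ⟨v', w'⟩ ⟨hv', hw'⟩ h
    simp only [Prod.map_apply, Prod.mk.injEq, List.cons.injEq, BranchIndex.left] at h
    obtain ⟨⟨hi, rfl⟩, hj, rfl⟩ := h
    obtain rfl := Fin.ext hj
    obtain rfl := Fin.ext hi
    obtain rfl : a = a' := Fin.ext (hv.2.symm.trans hv'.2)
    rfl

theorem mem_branchPairs {n : ℕ} (f : Fin n → PlaneTree) (m : ℕ) (v w : List ℕ) :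
    (v, w) ∈ branchPairs f m ↔ ∃ a v' b w', v = a :: v' ∧ w = b :: w' ∧ a < b ∧
      v ∈ vertexSet (mk f) ∧ w ∈ vertexSet (mk f) ∧ v.length + w.length = m + 1 := by
  simp only [branchPairs, Set.mem_iUnion, Set.mem_image, Prod.exists, Set.mem_prod, level,
    Set.mem_ofPred_eq, Prod.map_apply, Prod.mk.injEq]
  constructor
  · rintro ⟨⟨j, i, a⟩, v', w', ⟨⟨hv, hva⟩, hw, hwa⟩, rfl, rfl⟩
    refine ⟨_, v', _, w', rfl, rfl, i.2, ?_, ?_, ?_⟩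
    · exact (cons_val_mem_vertexSet_mk f _ _).2 hv
    · exact (cons_val_mem_vertexSet_mk f _ _).2 hw
    · have := a.2
      simp only [List.length_cons]
      simp only at hva hwa
      omega
  · rintro ⟨a, v', b, w', rfl, rfl, hab, hv, hw, hl⟩
    obtain ⟨i, rfl, hv'⟩ := (cons_mem_vertexSet_mk f _ _).1 hv
    obtain ⟨j, rfl, hw'⟩ := (cons_mem_vertexSet_mk f _ _).1 hw
    simp only [List.length_cons] at hl
    refine ⟨⟨j, ⟨i, hab⟩, ⟨v'.length, by omega⟩⟩, v', w', ⟨⟨hv', rfl⟩, hw', ?_⟩, rfl, rfl⟩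
    simp only
    omega

theorem _root_.lca_eq_nil_iff (v w : List ℕ) :
    lca v w = [] ↔ v = [] ∨ w = [] ∨ ∃ a v' b w', v = a :: v' ∧ w = b :: w' ∧ a ≠ b := by
  cases v <;> cases w <;> simp [lca]

theorem _root_.lca_comm (v w : List ℕ) : lca v w = lca w v := by
  induction v generalizing w with
  | nil => cases w <;> rfl
  | cons a v ih =>
    cases w with
    | nil => rfl
    | cons b w => by_cases h : a = b <;> simp [lca, h, eq_comm, ih]

theorem _root_.treeDist_of_lca_eq_nil {v w : List ℕ} (h : lca v w = []) :
    treeDist v w = v.length + w.length := by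
  simp [treeDist, dUp, h, lca_comm w v]

/-- Orders every unordered pair whose path of length `m + 1` passes through the root. -/
def orderedRootPairs {n : ℕ} (f : Fin n → PlaneTree) (m : ℕ) : Set (List ℕ × List ℕ) :=
  {[]} ×ˢ level (mk f) (m + 1) ∪ branchPairs f m

theorem mem_orderedRootPairs {n : ℕ} (f : Fin n → PlaneTree) (m : ℕ) (v w : List ℕ) :
    (v, w) ∈ orderedRootPairs f m ↔ v ∈ vertexSet (mk f) ∧ w ∈ vertexSet (mk f) ∧
      v.length + w.length = m + 1 ∧
      (v = [] ∨ ∃ a v' b w', v = a :: v' ∧ w = b :: w' ∧ a < b) := by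
  simp only [orderedRootPairs, Set.mem_union, mem_branchPairs, Set.mem_prod,
    Set.mem_singleton_iff, level, Set.mem_ofPred_eq]
  have := nil_mem_vertexSet (mk f)
  constructor
  · rintro (⟨rfl, hw, hl⟩ | h)
    · exact ⟨this, hw, by simpa using hl, .inl rfl⟩
    · grind
  · rintro ⟨hv, hw, hl, rfl | h⟩
    · exact .inl ⟨rfl, hw, by simpa using hl⟩
    · grind

theorem injOn_orderedRootPairs {n : ℕ} (f : Fin n → PlaneTree) (m : ℕ) :
    (orderedRootPairs f m).InjOn fun x => ({x.1, x.2} : Set (List ℕ)) := by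
  rintro ⟨v, w⟩ h ⟨v', w'⟩ h' heq
  rw [mem_orderedRootPairs] at h h'
  rcases Set.pair_eq_pair_iff.1 heq with ⟨h₁, h₂⟩ | ⟨h₁, h₂⟩
  · exact Prod.ext h₁ h₂
  · obtain ⟨-, -, hl, h⟩ := h
    obtain ⟨-, -, -, h'⟩ := h'
    simp only at h₁ h₂
    subst h₁ h₂
    rcases h with rfl | ⟨a, v', b, w', rfl, rfl, hab⟩
    · rcases h' with rfl | ⟨a, v', b, w', rfl, h, -⟩
      · simp at hl
      · simp at h
    · rcases h' with h | ⟨c, v'', d, w'', h, h', hcd⟩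
      · simp at h
      · simp only [List.cons.injEq] at h h'
        omega

theorem rootPairCount_mk {n : ℕ} (f : Fin n → PlaneTree) (m : ℕ) :
    rootPairCount (mk f) (m + 1) = (level (mk f) (m + 1)).ncard + ∑ x : BranchIndex n m,
      (level (f x.left) x.2.2).ncard * (level (f x.1) (m - 1 - x.2.2)).ncard := by
  have himage : {s : Set (List ℕ) | ∃ v w, v ∈ vertexSet (mk f) ∧ w ∈ vertexSet (mk f) ∧
      s = {v, w} ∧ treeDist v w = m + 1 ∧ lca v w = []} =
      (fun x : List ℕ × List ℕ => ({x.1, x.2} : Set (List ℕ))) '' orderedRootPairs f m := by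
    ext s
    simp only [Set.mem_ofPred_eq, Set.mem_image, Prod.exists, mem_orderedRootPairs]
    constructor
    · rintro ⟨v, w, hv, hw, rfl, hd, hl⟩
      rw [treeDist_of_lca_eq_nil hl] at hd
      rcases (lca_eq_nil_iff v w).1 hl with h | h | ⟨a, v', b, w', h, h', hab⟩
      · exact ⟨v, w, ⟨hv, hw, hd, .inl h⟩, rfl⟩
      · exact ⟨w, v, ⟨hw, hv, by omega, .inl h⟩, Set.pair_comm _ _⟩
      · rcases lt_or_gt_of_ne hab with hab | hab
        · exact ⟨v, w, ⟨hv, hw, hd, .inr ⟨a, v', b, w', h, h', hab⟩⟩, rfl⟩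
        · exact ⟨w, v, ⟨hw, hv, by omega, .inr ⟨b, w', a, v', h', h, hab⟩⟩, Set.pair_comm _ _⟩
    · rintro ⟨v, w, ⟨hv, hw, hd, h⟩, rfl⟩
      have hl : lca v w = [] := by
        rw [lca_eq_nil_iff]
        rcases h with h | ⟨a, v', b, w', h, h', hab⟩
        · exact .inl h
        · exact .inr (.inr ⟨a, v', b, w', h, h', hab.ne⟩)
      exact ⟨v, w, hv, hw, rfl, (treeDist_of_lca_eq_nil hl).trans hd, hl⟩
  rw [rootPairCount, pairCountThrough, himage, (injOn_orderedRootPairs f m).ncard_image,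
    orderedRootPairs, Set.ncard_union_eq _ ((Set.finite_singleton _).prod (level_finite _ _))
      (finite_branchPairs f m), Set.ncard_prod, Set.ncard_singleton, one_mul, ncard_branchPairs]
  refine Set.disjoint_left.2 ?_
  rintro ⟨v, w⟩ ⟨hv, -⟩ h
  obtain ⟨a, v', b, w', h, -⟩ := (mem_branchPairs f m v w).1 h
  simp only [Set.mem_singleton_iff] at hv
  simp [hv] at h

theorem card_branchIndex_mul_two (n m : ℕ) :
    Fintype.card (BranchIndex n m) * 2 = m * (n * (n - 1)) := by
  rw [← Finset.sum_range_id_mul_two, Finset.sum_range]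
  simp [Finset.mul_sum, Finset.sum_mul]
  exact Finset.sum_congr rfl fun _ _ => by ring

/-! ### Galton–Watson sums -/

theorem tsum_gwProb_mul (p : ℕ → ℝ≥0∞) (F : PlaneTree → ℝ≥0∞) :
    ∑' t, gwProb p t * F t =
      ∑' n, p n * ∑' f : Fin n → PlaneTree, (∏ i, gwProb p (f i)) * F (mk f) := by
  simp_rw [tsum_eq_tsum_mk, gwProb_mk, mul_assoc, ENNReal.tsum_mul_left]

/-- The total mass of the finite trees is a fixed point of the generating function. -/
theorem tsum_gwProb_eq_tsum_mul_pow (p : ℕ → ℝ≥0∞) :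
    ∑' t, gwProb p t = ∑' n, p n * (∑' t, gwProb p t) ^ n := by
  have h := tsum_gwProb_mul p fun _ => 1
  simp only [mul_one] at h
  refine h.trans (tsum_congr fun n => ?_)
  rw [ENNReal.tsum_fin_prod fun _ => gwProb p]
  simp

theorem tsum_gwProb_mul_ite_level_le_one (p : ℕ → ℝ≥0∞) (hp : ∑' n, p n = 1) (k : ℕ) :
    ∑' t, gwProb p t * (if (level t k).ncard = 0 then 1 else 0) ≤ 1 := by
  induction k with
  | zero => simp [level_zero]
  | succ k ih =>
    rw [tsum_gwProb_mul]
    refine (ENNReal.tsum_le_tsum fun n => mul_le_of_le_one_right' ?_).trans_eq hp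
    calc _ = ∑' f : Fin n → PlaneTree,
          ∏ i, gwProb p (f i) * (if (level (f i) k).ncard = 0 then 1 else 0) := by
          refine tsum_congr fun f => ?_
          rw [Finset.prod_mul_distrib, Finset.prod_ite_zero]
          simp [ncard_level_mk_succ]
      _ ≤ 1 := by
          rw [ENNReal.tsum_fin_prod
            fun _ t => gwProb p t * (if (level t k).ncard = 0 then 1 else 0)]
          exact Finset.prod_le_one' fun _ _ => ih

theorem tsum_gwProb_le_one (p : ℕ → ℝ≥0∞) (hp : ∑' n, p n = 1) : ∑' t, gwProb p t ≤ 1 := by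
  refine ENNReal.summable.tsum_le_of_sum_le fun s => ?_
  choose H hH using exists_ncard_level_eq_zero
  refine le_trans ?_ (tsum_gwProb_mul_ite_level_le_one p hp (s.sup H))
  refine le_trans (Finset.sum_le_sum fun t ht => ?_) (ENNReal.sum_le_tsum s)
  simp [hH t _ (Finset.le_sup ht)]

theorem exists_two_le_ne_zero {p : ℕ → ℝ≥0∞} (hp : ∑' n, p n = 1)
    (hmean : ∑' n : ℕ, (n : ℝ≥0∞) * p n = 1) (hvar : 0 < xiVar p) : ∃ n, 2 ≤ n ∧ p n ≠ 0 := by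
  by_contra! h
  have h₁ : p 1 = 1 := by
    rw [tsum_eq_single 1] at hmean
    · simpa using hmean
    · rintro (_ | _ | n) hn
      · simp
      · simp at hn
      · simp [h (n + 2) (by omega)]
  have h₀ : p 0 = 0 := by
    have := ENNReal.sum_le_tsum (f := p) (Finset.range 2)
    rw [hp, Finset.sum_range_succ, Finset.sum_range_one, h₁] at this
    by_contra h0
    exact absurd (ENNReal.lt_add_right ENNReal.one_ne_top h0) (by rwa [add_comm, not_lt])
  refine hvar.ne' (ENNReal.tsum_eq_zero.2 ?_)
  rintro (_ | _ | n)
  · simp [h₀]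
  · simp
  · simp [h (n + 2) (by omega)]

/-- A nondegenerate critical Galton–Watson tree is almost surely finite. -/
theorem tsum_gwProb {p : ℕ → ℝ≥0∞} (hp : ∑' n, p n = 1)
    (hmean : ∑' n : ℕ, (n : ℝ≥0∞) * p n = 1) (hvar : 0 < xiVar p) : ∑' t, gwProb p t = 1 := by
  have hfix := tsum_gwProb_eq_tsum_mul_pow p
  have hle := tsum_gwProb_le_one p hp
  set s := ∑' t, gwProb p t
  obtain ⟨t, hst⟩ := exists_add_of_le hle
  by_contra hs
  have ht : t ≠ 0 := by
    rintro rfl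
    exact hs (by simpa using hst.symm)
  obtain ⟨n, hn, hpn⟩ := exists_two_le_ne_zero hp hmean hvar
  have hpn' : p n ≠ ⊤ := ne_top_of_le_ne_top (hp ▸ ENNReal.one_ne_top) (ENNReal.le_tsum n)
  have hlt : ∑' n, p n < ∑' n, p n * (s ^ n + n * t) := by
    refine ENNReal.tsum_lt_tsum (i := n) (hp ▸ ENNReal.one_ne_top) (fun k => ?_) ?_
    · have : 1 ≤ s ^ k + k * t := by
        simpa using ENNReal.monotone_pow_add_mul hst.symm k.zero_le
      simpa using mul_le_mul_right this (p k)
    · simpa using ENNReal.mul_lt_mul_right hpn hpn'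
        (ENNReal.one_lt_pow_add_mul hst.symm ht hn)
  refine hlt.ne ?_
  have hmul (n : ℕ) : p n * (s ^ n + n * t) = p n * s ^ n + n * p n * t := by ring
  simp_rw [hmul]
  rw [ENNReal.tsum_add, ENNReal.tsum_mul_right, hmean, ← hfix, hp, one_mul, ← hst]

/-- The expected size of every level is one. -/
theorem tsum_gwProb_mul_ncard_level {p : ℕ → ℝ≥0∞} (hmean : ∑' n : ℕ, (n : ℝ≥0∞) * p n = 1)
    (hmass : ∑' t, gwProb p t = 1) (k : ℕ) :
    ∑' t, gwProb p t * ((level t k).ncard : ℝ≥0∞) = 1 := by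
  induction k with
  | zero => simpa [level_zero] using hmass
  | succ k ih =>
    rw [tsum_gwProb_mul, ← hmean]
    refine tsum_congr fun n => ?_
    simp_rw [ncard_level_mk_succ, Nat.cast_sum, Finset.mul_sum]
    rw [Summable.tsum_finsetSum fun _ _ => ENNReal.summable]
    simp_rw [ENNReal.tsum_fin_prod_mul_apply (gwProb p)
      (fun t => ((level t k).ncard : ℝ≥0∞)) hmass ih]
    simp [mul_comm]

theorem tsum_mul_descFactorial {p : ℕ → ℝ≥0∞} (hp : ∑' n, p n = 1)
    (hmean : ∑' n : ℕ, (n : ℝ≥0∞) * p n = 1) :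
    ∑' n : ℕ, p n * ((n * (n - 1) : ℕ) : ℝ≥0∞) = xiVar p := by
  refine (ENNReal.add_left_inj ENNReal.one_ne_top).1 ?_
  nth_rw 1 [← hp]
  rw [← hmean, xiVar, ← ENNReal.tsum_add, ← ENNReal.tsum_add]
  refine tsum_congr fun n => ?_
  have hsq : ((n * (n - 1) : ℕ) : ℝ≥0∞) + 1 = ENNReal.ofReal (((n : ℝ) - 1) ^ 2) + n := by
    rw [← ENNReal.ofReal_natCast n, ← ENNReal.ofReal_add (sq_nonneg _) n.cast_nonneg,
      ← Nat.cast_add_one, ← ENNReal.ofReal_natCast]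
    congr 1
    cases n with
    | zero => simp
    | succ n => push_cast [Nat.add_sub_cancel]; ring
  calc p n * ((n * (n - 1) : ℕ) : ℝ≥0∞) + p n
      = p n * (((n * (n - 1) : ℕ) : ℝ≥0∞) + 1) := by ring
    _ = _ := by rw [hsq]; ring

end PlaneTree

open PlaneTree

/-- equation (2.2) of Devroye–Janson.  For the unconditioned critical
Galton–Watson tree `𝒯`, `E Q_k(𝒯) = 1 + (k - 1) σ² / 2` for every `k ≥ 1`. -/
theorem expected_rootPairCount_gw
    (p : ℕ → ℝ≥0∞) (hp : ∑' k : ℕ, p k = 1)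
    (hmean : ∑' k : ℕ, (k : ℝ≥0∞) * p k = 1)
    (hvar_pos : 0 < xiVar p) (hvar_fin : xiVar p ≠ ⊤) :
    ∀ k : ℕ, 1 ≤ k →
      ∑' t : PlaneTree, gwProb p t * (rootPairCount t k : ℝ≥0∞)
        = 1 + ((k - 1 : ℕ) : ℝ≥0∞) * xiVar p / 2 := by
  intro k hk
  obtain ⟨m, rfl⟩ := Nat.exists_eq_add_of_le' hk
  have hmass := tsum_gwProb hp hmean hvar_pos
  have hlevel := tsum_gwProb_mul_ncard_level hmean hmass
  have hsplit (n : ℕ) : ∑' f : Fin n → PlaneTree, (∏ i, gwProb p (f i)) *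
      ((rootPairCount (mk f) (m + 1) : ℕ) : ℝ≥0∞) =
      ∑' f : Fin n → PlaneTree, (∏ i, gwProb p (f i)) * ((level (mk f) (m + 1)).ncard : ℝ≥0∞) +
        (Fintype.card (BranchIndex n m) : ℝ≥0∞) := by
    simp_rw [rootPairCount_mk, Nat.cast_add, mul_add, ENNReal.tsum_add, Nat.cast_sum,
      Finset.mul_sum, Nat.cast_mul]
    rw [Summable.tsum_finsetSum fun _ _ => ENNReal.summable]
    congr 1
    have hone (x : BranchIndex n m) := ENNReal.tsum_fin_prod_mul_apply_mul_apply (gwProb p)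
      (fun t => ((level t x.2.2).ncard : ℝ≥0∞)) (fun t => ((level t (m - 1 - x.2.2)).ncard : ℝ≥0∞))
      hmass (hlevel _) (hlevel _) (i := x.left) (j := x.1)
      (fun h => x.2.1.2.ne (congrArg Fin.val h))
    rw [Finset.sum_congr rfl fun x _ => hone x, Finset.sum_const, Finset.card_univ, nsmul_one]
  have hcard (n : ℕ) : (Fintype.card (BranchIndex n m) : ℝ≥0∞) =
      m * ((n * (n - 1) : ℕ) : ℝ≥0∞) / 2 := by
    rw [ENNReal.eq_div_iff two_ne_zero ENNReal.ofNat_ne_top, mul_comm]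
    exact_mod_cast card_branchIndex_mul_two n m
  rw [tsum_gwProb_mul]
  simp_rw [hsplit, mul_add]
  rw [ENNReal.tsum_add, ← tsum_gwProb_mul p fun t => ((level t (m + 1)).ncard : ℝ≥0∞), hlevel,
    Nat.add_sub_cancel, ← tsum_mul_descFactorial hp hmean, div_eq_mul_inv,
    ← ENNReal.tsum_mul_left, ← ENNReal.tsum_mul_right]
  congr 1
  refine tsum_congr fun n => ?_
  rw [hcard, div_eq_mul_inv]
  ring
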